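/- arXiv:1504.03106 — 6 statements merged into one kernel-verified Lean document; each statement's English description precedes it below -/
import Mathlib

section
/- Let T be a positive integer and let Z be a real symmetric T×T matrix. Then the function F(A) = tr(A⁻¹) + (1/2)‖A − Z‖_F², defined on the set of real symmetric positive definite T×T matrices, attains its minimum at a unique positive definite matrix; i.e., there exists a unique positive definite A* such that F(A*) ≤ F(A) for all positive definite A, and any positive definite A ≠ A* satisfies F(A*) < F(A). -/
open Matrix

lemma exists_pos_sub_inv_sq_eq (z : ℝ) : ∃ a : ℝ, 0 < a ∧ a - a⁻¹ * a⁻¹ = z := by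
  set l : ℝ := (1 + |z|)⁻¹ with hl
  have hz : 0 ≤ |z| := abs_nonneg z
  have hl0 : 0 < l := by positivity
  have hl1 : l ≤ 1 := inv_le_one_of_one_le₀ (by linarith)
  have hcont : ContinuousOn (fun a : ℝ => a - a⁻¹ * a⁻¹) (Set.Icc l (1 + |z|)) := by
    have h : ContinuousOn (fun a : ℝ => a⁻¹) (Set.Icc l (1 + |z|)) :=
      continuousOn_inv₀.mono fun x hx => (hl0.trans_le hx.1).ne'
    exact continuousOn_id.sub (h.mul h)
  have hmem : z ∈ Set.Icc (l - l⁻¹ * l⁻¹) ((1 + |z|) - (1 + |z|)⁻¹ * (1 + |z|)⁻¹) := by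
    constructor
    · rw [hl, inv_inv, ← hl]
      nlinarith [neg_abs_le z]
    · rw [← hl]
      nlinarith [le_abs_self z]
  obtain ⟨a, ha, hza⟩ := intermediate_value_Icc (by linarith) hcont hmem
  exact ⟨a, hl0.trans_le ha.1, hza⟩

lemma Matrix.IsHermitian.exists_posDef_sub_eq_inv_mul_inv {n : Type*} [Fintype n] [DecidableEq n]
    {Z : Matrix n n ℝ} (hZ : Z.IsHermitian) :
    ∃ S : Matrix n n ℝ, S.PosDef ∧ S - Z = S⁻¹ * S⁻¹ := by
  obtain ⟨U, d, hUU, hUU', rfl⟩ : ∃ (U : Matrix n n ℝ) (d : n → ℝ),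
      star U * U = 1 ∧ U * star U = 1 ∧ Z = U * diagonal d * star U :=
    ⟨hZ.eigenvectorUnitary.1, hZ.eigenvalues, Unitary.coe_star_mul_self hZ.eigenvectorUnitary,
      Unitary.coe_mul_star_self hZ.eigenvectorUnitary, hZ.spectral_theorem⟩
  choose a ha haz using fun i => exists_pos_sub_inv_sq_eq (d i)
  have hconj (D E : Matrix n n ℝ) :
      (U * D * star U) * (U * E * star U) = U * (D * E) * star U := by
    calc _ = U * D * (star U * U) * E * star U := by simp only [Matrix.mul_assoc]
      _ = _ := by rw [hUU, Matrix.mul_one]; simp only [Matrix.mul_assoc]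
  have hinv : (U * diagonal a * star U)⁻¹ = U * diagonal (fun i => (a i)⁻¹) * star U := by
    apply Matrix.inv_eq_right_inv
    rw [hconj, diagonal_mul_diagonal]
    simp [fun i => mul_inv_cancel₀ (ha i).ne', hUU']
  refine ⟨U * diagonal a * star U, ?_, ?_⟩
  · rw [IsUnit.posDef_star_right_conjugate_iff (IsUnit.of_mul_eq_one _ hUU')]
    exact PosDef.diagonal ha
  · rw [hinv, hconj, diagonal_mul_diagonal]
    rw [← Matrix.sub_mul, ← Matrix.mul_sub, diagonal_sub]
    congr 3
    ext i
    linarith [haz i]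

lemma Matrix.PosDef.trace_inv_sub_inv_add_nonneg {n : Type*} [Fintype n] [DecidableEq n]
    {A S : Matrix n n ℝ} (hA : A.PosDef) (hS : S.PosDef) :
    0 ≤ A⁻¹.trace - S⁻¹.trace + (S⁻¹ * S⁻¹ * (A - S)).trace := by
  have hAi : A⁻¹ * A = 1 := Matrix.nonsing_inv_mul A ((isUnit_iff_isUnit_det A).mp hA.isUnit)
  have hAi' : A * A⁻¹ = 1 := Matrix.mul_nonsing_inv A ((isUnit_iff_isUnit_det A).mp hA.isUnit)
  have hSi : S⁻¹ * S = 1 := Matrix.nonsing_inv_mul S ((isUnit_iff_isUnit_det S).mp hS.isUnit)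
  have h := (hA.posSemidef.conjTranspose_mul_mul_same (A⁻¹ - S⁻¹)).trace_nonneg
  rw [(hA.inv.isHermitian.sub hS.inv.isHermitian).eq] at h
  have hexp : (A⁻¹ - S⁻¹) * A * (A⁻¹ - S⁻¹) = A⁻¹ - S⁻¹ - S⁻¹ + S⁻¹ * A * S⁻¹ := by
    rw [Matrix.sub_mul, hAi, Matrix.sub_mul, Matrix.one_mul, Matrix.mul_sub,
      Matrix.mul_assoc S⁻¹ A A⁻¹, hAi', Matrix.mul_one]
    abel
  rw [hexp] at h
  have hcyc : (S⁻¹ * A * S⁻¹).trace = (S⁻¹ * S⁻¹ * A).trace := by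
    rw [Matrix.trace_mul_comm, Matrix.mul_assoc]
  rw [Matrix.mul_sub, Matrix.mul_assoc S⁻¹ S⁻¹ S, hSi, Matrix.mul_one]
  simp only [trace_add, trace_sub, hcyc] at h ⊢
  linarith

lemma Matrix.sum_sq_add_of_isSymm {n : Type*} [Fintype n] {C D : Matrix n n ℝ} (hC : C.IsSymm) :
    ∑ i, ∑ j, ((D + C) i j) ^ 2 =
      ∑ i, ∑ j, (D i j) ^ 2 + 2 * (C * D).trace + ∑ i, ∑ j, (C i j) ^ 2 := by
  have h : (C * D).trace = ∑ i, ∑ j, C i j * D i j := by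
    simp only [trace, diag_apply, mul_apply]
    rw [Finset.sum_comm]
    exact Finset.sum_congr rfl fun i _ => Finset.sum_congr rfl fun j _ => by rw [hC.apply]
  rw [h]
  simp only [Finset.mul_sum, ← Finset.sum_add_distrib, add_apply]
  exact Finset.sum_congr rfl fun i _ => Finset.sum_congr rfl fun j _ => by ring

lemma Matrix.sum_sq_pos {m n : Type*} [Fintype m] [Fintype n] {D : Matrix m n ℝ} (hD : D ≠ 0) :
    0 < ∑ i, ∑ j, (D i j) ^ 2 := by
  refine lt_of_le_of_ne (by positivity) fun h => hD ?_
  ext i j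
  have hi := (Finset.sum_eq_zero_iff_of_nonneg fun i _ => by positivity).mp h.symm i
    (Finset.mem_univ i)
  have hij := (Finset.sum_eq_zero_iff_of_nonneg fun j _ => by positivity).mp hi j
    (Finset.mem_univ j)
  simpa using hij

/-- The function `F(A) = tr(A⁻¹) + (1/2)‖A − Z‖_F²` on real symmetric
positive definite `T×T` matrices attains its minimum at a unique positive definite matrix. -/
theorem stmt_0 (T : ℕ) (hT : 0 < T) (Z : Matrix (Fin T) (Fin T) ℝ) (hZ : Z.IsSymm) :
    ∃ Astar : Matrix (Fin T) (Fin T) ℝ, Astar.PosDef ∧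
      (∀ A : Matrix (Fin T) (Fin T) ℝ, A.PosDef →
        (Astar⁻¹.trace + (1 / 2) * ∑ i, ∑ j, ((Astar - Z) i j) ^ 2)
          ≤ (A⁻¹.trace + (1 / 2) * ∑ i, ∑ j, ((A - Z) i j) ^ 2)) ∧
      (∀ A : Matrix (Fin T) (Fin T) ℝ, A.PosDef → A ≠ Astar →
        (Astar⁻¹.trace + (1 / 2) * ∑ i, ∑ j, ((Astar - Z) i j) ^ 2)
          < (A⁻¹.trace + (1 / 2) * ∑ i, ∑ j, ((A - Z) i j) ^ 2)) := by
  have hZH : Z.IsHermitian := by rw [IsHermitian, conjTranspose_eq_transpose_of_trivial, hZ.eq]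
  obtain ⟨S, hS, hSZ⟩ := hZH.exists_posDef_sub_eq_inv_mul_inv
  have hsymm : (S - Z).IsSymm := by
    have h := (hS.isHermitian.sub hZH).eq
    rwa [conjTranspose_eq_transpose_of_trivial] at h
  have key (A : Matrix (Fin T) (Fin T) ℝ) (hA : A.PosDef) (hne : A ≠ S) :
      S⁻¹.trace + (1 / 2) * ∑ i, ∑ j, ((S - Z) i j) ^ 2
        < A⁻¹.trace + (1 / 2) * ∑ i, ∑ j, ((A - Z) i j) ^ 2 := by
    have hsum := sum_sq_add_of_isSymm (D := A - S) hsymm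
    rw [sub_add_sub_cancel] at hsum
    have htr := hA.trace_inv_sub_inv_add_nonneg hS
    rw [← hSZ] at htr
    linarith [sum_sq_pos (sub_ne_zero.mpr hne)]
  refine ⟨S, hS, fun A hA => ?_, key⟩
  obtain rfl | hne := eq_or_ne A S
  · exact le_rfl
  · exact (key A hA hne).le
end

section
/- Let Z = UΣUᵀ where U is a real orthogonal T×T matrix and Σ is a real diagonal T×T matrix. Let Λ be the diagonal T×T matrix whose t-th diagonal entry Λ_tt is a positive real number satisfying Λ_tt³ − Σ_tt·Λ_tt² − 1 = 0 for each t. Then A = UΛUᵀ is symmetric positive definite and satisfies A³ − A²Z − I_T = 0. -/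
open Matrix

/-- If `Z = U D Uᵀ` with `U` orthogonal and `D` diagonal, and `Λ` is diagonal with
positive diagonal entries satisfying `Λ_tt³ − D_tt Λ_tt² − 1 = 0`, then `A = U Λ Uᵀ` is symmetric
positive definite and satisfies `A³ − A²Z − I = 0`. -/
theorem stmt_3 (T : ℕ) (U D Λ Z : Matrix (Fin T) (Fin T) ℝ)
    (hU₁ : U * Uᵀ = 1) (hU₂ : Uᵀ * U = 1)
    (hD : D.IsDiag) (hΛ : Λ.IsDiag)
    (hZ : Z = U * D * Uᵀ)
    (hpos : ∀ t, 0 < Λ t t)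
    (hroot : ∀ t, (Λ t t) ^ 3 - D t t * (Λ t t) ^ 2 - 1 = 0) :
    (U * Λ * Uᵀ).IsSymm ∧ (U * Λ * Uᵀ).PosDef ∧
      (U * Λ * Uᵀ) ^ 3 - (U * Λ * Uᵀ) ^ 2 * Z - 1 = 0 := by
  have hdiag : Λ ^ 3 - Λ ^ 2 * D - 1 = 0 := by
    rw [← hΛ.diagonal_diag, ← hD.diagonal_diag, diagonal_pow, diagonal_pow, diagonal_mul_diagonal,
      ← diagonal_one, diagonal_sub, diagonal_sub, diagonal_eq_zero]
    funext t
    simpa [mul_comm] using hroot t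
  have hconj : ∀ M N : Matrix (Fin T) (Fin T) ℝ,
      (U * M * Uᵀ) * (U * N * Uᵀ) = U * (M * N) * Uᵀ := fun M N => by
    calc (U * M * Uᵀ) * (U * N * Uᵀ) = U * M * (Uᵀ * U) * N * Uᵀ := by noncomm_ring
      _ = U * (M * N) * Uᵀ := by rw [hU₂]; noncomm_ring
  refine ⟨?_, ?_, ?_⟩
  · simp only [IsSymm, transpose_mul, transpose_transpose, hΛ.isSymm.eq, Matrix.mul_assoc]
  · have hΛpos : Λ.PosDef := by
      rw [← hΛ.diagonal_diag]
      exact PosDef.diagonal hpos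
    rw [← conjTranspose_eq_transpose_of_trivial]
    exact hΛpos.mul_mul_conjTranspose_same
      (vecMul_injective_of_isUnit (IsUnit.of_mul_eq_one _ hU₁))
  · calc (U * Λ * Uᵀ) ^ 3 - (U * Λ * Uᵀ) ^ 2 * Z - 1
        = U * Λ ^ 3 * Uᵀ - U * (Λ ^ 2 * D) * Uᵀ - U * Uᵀ := by
          rw [hZ, hU₁, pow_succ, pow_two, hconj, hconj, hconj, pow_succ Λ 2, pow_two Λ]
      _ = U * (Λ ^ 3 - Λ ^ 2 * D - 1) * Uᵀ := by noncomm_ring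
      _ = 0 := by rw [hdiag, Matrix.mul_zero, Matrix.zero_mul]
end

section
/- Let Z be a real symmetric T×T matrix with eigendecomposition Z = UΣUᵀ, where U is orthogonal and Σ is diagonal. Let Λ be the diagonal matrix whose t-th diagonal entry Λ_tt is the unique positive root of the polynomial λ³ − Σ_tt·λ² − 1. Then A* = UΛUᵀ is the unique minimizer over all real symmetric positive definite T×T matrices A of the function F(A) = tr(A⁻¹) + (1/2)‖A − Z‖_F². -/
open Matrix

namespace Matrix

variable {n : Type*} [Fintype n]

theorem trace_transpose_mul_eq_sum (M N : Matrix n n ℝ) :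
    (Mᵀ * N).trace = ∑ i, ∑ j, M i j * N i j := by
  simp only [trace, diag, mul_apply, transpose_apply]
  exact Finset.sum_comm

theorem eq_of_sum_sq_sub_nonpos {A P : Matrix n n ℝ}
    (h : ∑ i, ∑ j, ((A - P) i j) ^ 2 ≤ 0) : A = P := by
  have h0 := le_antisymm h (Finset.sum_nonneg fun i _ => Finset.sum_nonneg fun j _ =>
    sq_nonneg ((A - P) i j))
  ext i j
  rw [Finset.sum_eq_zero_iff_of_nonneg
    fun i _ => Finset.sum_nonneg fun j _ => sq_nonneg ((A - P) i j)] at h0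
  have hi := h0 i (Finset.mem_univ i)
  rw [Finset.sum_eq_zero_iff_of_nonneg fun j _ => sq_nonneg ((A - P) i j)] at hi
  exact sub_eq_zero.1 ((pow_eq_zero_iff two_ne_zero).1 (hi j (Finset.mem_univ j)))

variable [DecidableEq n]

/-- The tangent-plane inequality for the convex function `A ↦ tr A⁻¹`. -/
theorem PosDef.trace_inv_sub_le {A P : Matrix n n ℝ} (hA : A.PosDef) (hP : P.PosDef) :
    P⁻¹.trace - (P⁻¹ * P⁻¹ * (A - P)).trace ≤ A⁻¹.trace := by
  have hAd : IsUnit A.det := (isUnit_iff_isUnit_det A).1 hA.isUnit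
  have hPd : IsUnit P.det := (isUnit_iff_isUnit_det P).1 hP.isUnit
  have hH : (A⁻¹ - P⁻¹)ᴴ = A⁻¹ - P⁻¹ := hA.inv.isHermitian.sub hP.inv.isHermitian
  have h := (hA.posSemidef.conjTranspose_mul_mul_same (A⁻¹ - P⁻¹)).trace_nonneg
  have e : (A⁻¹ - P⁻¹) * A * (A⁻¹ - P⁻¹) = A⁻¹ - P⁻¹ - P⁻¹ + P⁻¹ * A * P⁻¹ := by
    rw [sub_mul, nonsing_inv_mul A hAd, sub_mul, one_mul, mul_sub, mul_assoc P⁻¹ A A⁻¹,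
      mul_nonsing_inv A hAd, mul_one]
    abel
  have t : (P⁻¹ * P⁻¹ * (A - P)).trace = (P⁻¹ * A * P⁻¹).trace - P⁻¹.trace := by
    rw [mul_sub, trace_sub, mul_assoc P⁻¹ P⁻¹ P, nonsing_inv_mul P hPd, mul_one, mul_assoc,
      trace_mul_comm]
  rw [hH, e] at h
  simp only [trace_add, trace_sub] at h
  linarith

/-- If `P` is a critical point of `A ↦ tr A⁻¹ + ‖A - Z‖² / 2`, this function grows at least
quadratically away from `P`. -/
theorem PosDef.trace_inv_add_quadratic_growth {A P Z : Matrix n n ℝ} (hA : A.PosDef)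
    (hP : P.PosDef) (hcrit : P - Z = P⁻¹ * P⁻¹) :
    P⁻¹.trace + (1 / 2) * ∑ i, ∑ j, ((P - Z) i j) ^ 2
        + (1 / 2) * ∑ i, ∑ j, ((A - P) i j) ^ 2
      ≤ A⁻¹.trace + (1 / 2) * ∑ i, ∑ j, ((A - Z) i j) ^ 2 := by
  have hsymm : (P⁻¹ * P⁻¹)ᵀ = P⁻¹ * P⁻¹ := by
    have h : (P⁻¹)ᵀ = P⁻¹ := by simpa using hP.inv.isHermitian.eq
    rw [transpose_mul, h]
  have hcross := trace_transpose_mul_eq_sum (P - Z) (A - P)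
  rw [hcrit, hsymm, ← hcrit] at hcross
  have hexp : ∑ i, ∑ j, ((A - Z) i j) ^ 2 = ∑ i, ∑ j, ((P - Z) i j) ^ 2
      + 2 * (∑ i, ∑ j, (P - Z) i j * (A - P) i j) + ∑ i, ∑ j, ((A - P) i j) ^ 2 := by
    simp only [Finset.mul_sum, ← Finset.sum_add_distrib]
    refine Finset.sum_congr rfl fun i _ => Finset.sum_congr rfl fun j _ => ?_
    simp only [sub_apply]
    ring
  have htan := hA.trace_inv_sub_le hP
  rw [← hcrit] at htan
  rw [hexp]
  linarith

theorem conj_diagonal_mul_conj_diagonal {U : Matrix n n ℝ} (hU : Uᵀ * U = 1) (a b : n → ℝ) :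
    (U * diagonal a * Uᵀ) * (U * diagonal b * Uᵀ) = U * diagonal (fun t => a t * b t) * Uᵀ := by
  rw [← diagonal_mul_diagonal]
  calc _ = U * diagonal a * (Uᵀ * U) * diagonal b * Uᵀ := by simp only [mul_assoc]
    _ = _ := by rw [hU, mul_one, mul_assoc U]

end Matrix

/-- If `Z` is real symmetric with eigendecomposition `Z = U D Uᵀ` (`U` orthogonal,
`D` diagonal) and `Λ` is the diagonal matrix whose `t`-th diagonal entry is the unique positive
root of `λ³ − D_tt λ² − 1`, then `A* = U Λ Uᵀ` is the unique minimizer over real symmetric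
positive definite matrices of `F(A) = tr(A⁻¹) + (1/2)‖A − Z‖_F²`. -/
theorem stmt_4 (T : ℕ) (Z U D Λ : Matrix (Fin T) (Fin T) ℝ)
    (hZ : Z.IsSymm)
    (hU₁ : U * Uᵀ = 1) (hU₂ : Uᵀ * U = 1)
    (hD : D.IsDiag)
    (hdec : Z = U * D * Uᵀ)
    (hΛ : Λ.IsDiag)
    (hpos : ∀ t, 0 < Λ t t)
    (hroot : ∀ t, (Λ t t) ^ 3 - D t t * (Λ t t) ^ 2 - 1 = 0) :
    (U * Λ * Uᵀ).PosDef ∧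
    (∀ A : Matrix (Fin T) (Fin T) ℝ, A.PosDef →
      ((U * Λ * Uᵀ)⁻¹.trace + (1 / 2) * ∑ i, ∑ j, ((U * Λ * Uᵀ - Z) i j) ^ 2)
        ≤ (A⁻¹.trace + (1 / 2) * ∑ i, ∑ j, ((A - Z) i j) ^ 2)) ∧
    (∀ A : Matrix (Fin T) (Fin T) ℝ, A.PosDef →
      (∀ B : Matrix (Fin T) (Fin T) ℝ, B.PosDef →
        (A⁻¹.trace + (1 / 2) * ∑ i, ∑ j, ((A - Z) i j) ^ 2)
          ≤ (B⁻¹.trace + (1 / 2) * ∑ i, ∑ j, ((B - Z) i j) ^ 2)) →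
      A = U * Λ * Uᵀ) := by
  obtain ⟨d, rfl⟩ : ∃ d, D = diagonal d := ⟨D.diag, hD.diagonal_diag.symm⟩
  obtain ⟨l, rfl⟩ : ∃ l, Λ = diagonal l := ⟨Λ.diag, hΛ.diagonal_diag.symm⟩
  simp only [diagonal_apply_eq] at hpos hroot
  have hP : (U * diagonal l * Uᵀ).PosDef := by
    have hinj : Function.Injective U.vecMul :=
      vecMul_injective_of_isUnit (isUnit_iff_exists.2 ⟨Uᵀ, hU₁, hU₂⟩)
    simpa using (PosDef.diagonal hpos).mul_mul_conjTranspose_same hinj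
  have hinv : (U * diagonal l * Uᵀ)⁻¹ = U * diagonal (fun t => (l t)⁻¹) * Uᵀ := by
    refine inv_eq_right_inv ?_
    rw [conj_diagonal_mul_conj_diagonal hU₂]
    simp [fun t => mul_inv_cancel₀ (hpos t).ne', hU₁]
  have hcrit : U * diagonal l * Uᵀ - Z
      = (U * diagonal l * Uᵀ)⁻¹ * (U * diagonal l * Uᵀ)⁻¹ := by
    rw [hinv, conj_diagonal_mul_conj_diagonal hU₂, hdec, ← sub_mul, ← mul_sub, diagonal_sub]
    congr 3
    ext t
    have ht := (hpos t).ne'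
    field_simp
    linarith [hroot t]
  refine ⟨hP, fun A hA => ?_, fun A hA hmin => eq_of_sum_sq_sub_nonpos ?_⟩
  · have hgrow := hA.trace_inv_add_quadratic_growth hP hcrit
    have hsq : 0 ≤ ∑ i, ∑ j, ((A - U * diagonal l * Uᵀ) i j) ^ 2 :=
      Finset.sum_nonneg fun i _ => Finset.sum_nonneg fun j _ => sq_nonneg _
    linarith
  · have hgrow := hA.trace_inv_add_quadratic_growth hP hcrit
    linarith [hmin _ hP]
end

section
/- Let X be a real symmetric positive semidefinite T×T matrix. Then the function A ↦ tr(A⁻¹X) is convex on the cone of real symmetric positive definite T×T matrices: for all positive definite symmetric A, B and all θ ∈ [0,1], tr((θA + (1−θ)B)⁻¹X) ≤ θ·tr(A⁻¹X) + (1−θ)·tr(B⁻¹X). -/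
open Matrix

namespace Matrix

variable {n : Type*} [Fintype n]

theorem PosSemidef.trace_mul_nonneg {P X : Matrix n n ℝ} (hP : P.PosSemidef)
    (hX : X.PosSemidef) : 0 ≤ (P * X).trace := by
  obtain ⟨m, v, rfl⟩ := posSemidef_iff_eq_sum_vecMulVec.mp hX
  rw [Finset.mul_sum, trace_sum]
  refine Finset.sum_nonneg fun i _ => ?_
  rw [mul_vecMulVec, trace_vecMulVec, dotProduct_comm]
  exact hP.dotProduct_mulVec_nonneg (v i)

variable [DecidableEq n]

theorem PosDef.fromBlocks_one_inv_posSemidef {A : Matrix n n ℝ} (hA : A.PosDef) :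
    (fromBlocks A 1 1 A⁻¹).PosSemidef := by
  have := hA.isUnit.invertible
  have h := (PosDef.fromBlocks₁₁ (1 : Matrix n n ℝ) A⁻¹ hA).mpr
    (by simpa using PosSemidef.zero)
  simpa using h

/-- Operator convexity of the matrix inverse on positive definite matrices. -/
theorem PosDef.inv_convexComb_posSemidef {A B : Matrix n n ℝ} (hA : A.PosDef) (hB : B.PosDef)
    {a b : ℝ} (ha : 0 ≤ a) (hb : 0 ≤ b) (hab : a + b = 1) :
    (a • A⁻¹ + b • B⁻¹ - (a • A + b • B)⁻¹).PosSemidef := by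
  have hC : (a • A + b • B).PosDef := by
    rcases ha.eq_or_lt with rfl | ha
    · obtain rfl : b = 1 := by linarith
      simpa using hB
    · exact (hA.smul ha).add_posSemidef (hB.posSemidef.smul hb)
  have := hC.isUnit.invertible
  have h := (hA.fromBlocks_one_inv_posSemidef.smul ha).add
    (hB.fromBlocks_one_inv_posSemidef.smul hb)
  rw [fromBlocks_smul, fromBlocks_smul, fromBlocks_add, ← add_smul, hab, one_smul] at h
  simpa using (PosDef.fromBlocks₁₁ (1 : Matrix n n ℝ) (a • A⁻¹ + b • B⁻¹) hC).mp
    (by simpa using h)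

end Matrix

/-- For `X` real symmetric positive semidefinite, `A ↦ tr(A⁻¹X)` is convex on the
cone of real symmetric positive definite matrices. -/
theorem stmt_6 (T : ℕ) (X : Matrix (Fin T) (Fin T) ℝ) (hX : X.PosSemidef)
    (A B : Matrix (Fin T) (Fin T) ℝ) (hA : A.PosDef) (hB : B.PosDef)
    (θ : ℝ) (hθ : θ ∈ Set.Icc (0 : ℝ) 1) :
    ((θ • A + (1 - θ) • B)⁻¹ * X).trace ≤ θ * (A⁻¹ * X).trace + (1 - θ) * (B⁻¹ * X).trace := by
  have h := (hA.inv_convexComb_posSemidef hB hθ.1 (sub_nonneg.mpr hθ.2)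
    (add_sub_cancel θ 1)).trace_mul_nonneg hX
  rw [Matrix.sub_mul, Matrix.add_mul, Matrix.smul_mul, Matrix.smul_mul, trace_sub, trace_add,
    trace_smul, trace_smul, smul_eq_mul, smul_eq_mul] at h
  exact sub_nonneg.mp h
end

section
/- Compactness of regularizer sub-level sets: for any ε > 0, μ > 0, and c ∈ ℝ, the set { A ∈ ℝ^{T×T} : A symmetric positive definite and ε·tr(A⁻¹) + μ·tr(A) ≤ c } is a compact subset of the space of real T×T matrices. -/
open Matrix

namespace Matrix

variable {n : Type*}

theorem PosSemidef.abs_apply_le_trace [Fintype n] {A : Matrix n n ℝ} (hA : A.PosSemidef) (i j : n) :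
    |A i j| ≤ A.trace := by
  classical
  have hdiag (k : n) : A k k ≤ A.trace :=
    Finset.single_le_sum (f := fun k => A k k) (fun _ _ => hA.diag_nonneg) (Finset.mem_univ k)
  have hsymm : A j i = A i j := by simpa using hA.isHermitian.apply i j
  have hadd := hA.dotProduct_mulVec_nonneg (Pi.single i 1 + Pi.single j 1)
  have hsub := hA.dotProduct_mulVec_nonneg (Pi.single i 1 - Pi.single j 1)
  simp [mulVec_add, mulVec_sub] at hadd hsub
  rw [abs_le]
  constructor <;> linarith [hdiag i, hdiag j]

theorem isClosed_setOf_posSemidef [Fintype n] : IsClosed {A : Matrix n n ℝ | A.PosSemidef} := by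
  simp only [posSemidef_iff_dotProduct_mulVec, Set.ofPred_and, Set.ofPred_forall]
  refine .inter (isClosed_eq (by fun_prop) continuous_id) (isClosed_iInter fun x => ?_)
  exact isClosed_le continuous_const (by fun_prop)

theorem isCompact_setOf_abs_apply_le (r : ℝ) :
    IsCompact {A : Matrix n n ℝ | ∀ i j, |A i j| ≤ r} := by
  have h : {A : Matrix n n ℝ | ∀ i j, |A i j| ≤ r} =
      (Set.univ.pi fun _ : n => Set.univ.pi fun _ : n => Set.Icc (-r) r : Set (n → n → ℝ)) := by
    ext A
    simp only [Set.mem_ofPred_eq, abs_le]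
    exact ⟨fun h i _ j _ => h i j, fun h i j => h i trivial j trivial⟩
  rw [h]
  exact isCompact_univ_pi fun _ => isCompact_univ_pi fun _ => isCompact_Icc

theorem isCompact_posSemidef_pairs_of_trace_le [Fintype n] [DecidableEq n] {ε μ : ℝ}
    (hε : 0 < ε) (hμ : 0 < μ) (c : ℝ) :
    IsCompact {p : Matrix n n ℝ × Matrix n n ℝ | p.1.PosSemidef ∧ p.2.PosSemidef ∧
      p.1 * p.2 = 1 ∧ ε * p.2.trace + μ * p.1.trace ≤ c} := by
  refine ((isCompact_setOf_abs_apply_le (c / μ)).prod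
    (isCompact_setOf_abs_apply_le (c / ε))).of_isClosed_subset ?_ ?_
  · simp only [Set.ofPred_and]
    refine (isClosed_setOf_posSemidef.preimage continuous_fst).inter
      ((isClosed_setOf_posSemidef.preimage continuous_snd).inter (.inter ?_ ?_))
    · exact isClosed_eq (by fun_prop) continuous_const
    · exact isClosed_le (by fun_prop) continuous_const
  · rintro ⟨A, B⟩ ⟨hA, hB, -, hc⟩
    have hA' := mul_nonneg hμ.le hA.trace_nonneg
    have hB' := mul_nonneg hε.le hB.trace_nonneg
    refine ⟨fun i j => (hA.abs_apply_le_trace i j).trans ?_,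
      fun i j => (hB.abs_apply_le_trace i j).trans ?_⟩
    · rw [le_div_iff₀' hμ]
      linarith
    · rw [le_div_iff₀' hε]
      linarith

end Matrix

/-- For `ε, μ > 0` and any `c`, the sub-level set
`{A symmetric positive definite : ε·tr(A⁻¹) + μ·tr(A) ≤ c}` is compact. -/
theorem stmt_13 (T : ℕ) (ε μ : ℝ) (hε : 0 < ε) (hμ : 0 < μ) (c : ℝ) :
    IsCompact {A : Matrix (Fin T) (Fin T) ℝ |
      A.PosDef ∧ ε * (A⁻¹).trace + μ * A.trace ≤ c} := by
  convert (isCompact_posSemidef_pairs_of_trace_le (n := Fin T) hε hμ c).image continuous_fst using 1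
  ext A
  constructor
  · rintro ⟨hA, hc⟩
    exact ⟨(A, A⁻¹), ⟨hA.posSemidef, hA.inv.posSemidef,
      mul_nonsing_inv A (A.isUnit_iff_isUnit_det.mp hA.isUnit), hc⟩, rfl⟩
  · rintro ⟨⟨A, B⟩, ⟨hA, -, hAB, hc⟩, rfl⟩
    refine ⟨hA.posDef_iff_isUnit.mpr (.of_mul_eq_one B hAB), ?_⟩
    rwa [inv_eq_right_inv hAB]
end

section
/- Joint convexity of the Sparse Kernel MTL objective (restricted matrix form): let K be a real symmetric positive semidefinite n×n matrix, ℓ: ℝ^{n×T} → ℝ a convex function, λ ≥ 0, ε ≥ 0, and μ ∈ [0,1]. Then the function S(B, A) = ℓ(KB) + λ·( tr(Bᵀ K B A⁻¹) + ε·tr(A⁻¹) + μ·tr(A) + (1−μ)·Σ_{t,s} |A_{ts}| ), defined for B ∈ ℝ^{n×T} and A a real symmetric positive definite T×T matrix, is jointly convex: for all (B₁, A₁), (B₂, A₂) in its domain and θ ∈ [0,1], S(θB₁ + (1−θ)B₂, θA₁ + (1−θ)A₂) ≤ θ·S(B₁, A₁) + (1−θ)·S(B₂, A₂). -/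
open Matrix

/-- Positive definite matrices are closed under convex combinations. -/
theorem posDef_convex_comb {k : Type*} {A₁ A₂ : Matrix k k ℝ} (h1 : A₁.PosDef) (h2 : A₂.PosDef)
    {a b : ℝ} (ha : 0 ≤ a) (hb : 0 ≤ b) (hab : a + b = 1) : (a • A₁ + b • A₂).PosDef := by
  rcases ha.eq_or_lt with rfl | ha
  · obtain rfl : b = 1 := by linarith
    simpa using h2
  · exact (h1.smul ha).add_posSemidef (h2.posSemidef.smul hb)

/-- Convexity of the entrywise `ℓ₁` norm. -/
theorem sum_abs_convex {k : Type*} [Fintype k] (A₁ A₂ : Matrix k k ℝ)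
    {a b : ℝ} (ha : 0 ≤ a) (hb : 0 ≤ b) :
    ∑ t, ∑ s, |(a • A₁ + b • A₂) t s| ≤
      a * ∑ t, ∑ s, |A₁ t s| + b * ∑ t, ∑ s, |A₂ t s| := by
  simp only [Finset.mul_sum, ← Finset.sum_add_distrib]
  refine Finset.sum_le_sum fun t _ => Finset.sum_le_sum fun s _ => ?_
  simpa [abs_mul, abs_of_nonneg ha, abs_of_nonneg hb] using abs_add_le (a * A₁ t s) (b * A₂ t s)

section MatrixFractional

variable {m k : Type*} [Fintype m] [Fintype k] [DecidableEq k]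

open scoped MatrixOrder in
/-- The trace of a product of two real positive semidefinite matrices is nonnegative. -/
theorem trace_mul_nonneg_of_posSemidef {M N : Matrix k k ℝ}
    (hM : M.PosSemidef) (hN : N.PosSemidef) : 0 ≤ (M * N).trace := by
  obtain ⟨P, rfl⟩ := CStarAlgebra.nonneg_iff_eq_star_mul_self.mp hN.nonneg
  rw [← Matrix.mul_assoc, trace_mul_comm, ← Matrix.mul_assoc]
  exact (hM.mul_mul_conjTranspose_same P).trace_nonneg

/-- Completing the square for the matrix fractional function. -/
theorem trace_fractional_sub_eq {K : Matrix m m ℝ} (hK : K.PosSemidef)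
    (B C : Matrix m k ℝ) {A : Matrix k k ℝ} (hA : A.PosDef) :
    (Bᵀ * K * B * A⁻¹).trace - (2 * (Bᵀ * K * C).trace - (Cᵀ * K * C * A).trace) =
      ((B - C * A)ᵀ * K * (B - C * A) * A⁻¹).trace := by
  have hdet : IsUnit A.det := hA.det_pos.ne'.isUnit
  have hAt : Aᵀ = A := by simpa using hA.isHermitian.eq
  have hKt : Kᵀ = K := by simpa using hK.isHermitian.eq
  have hexp : (B - C * A)ᵀ * K * (B - C * A) * A⁻¹ =
      Bᵀ * K * B * A⁻¹ - Bᵀ * K * C - A * (Cᵀ * K * B * A⁻¹) + A * (Cᵀ * K * C) := by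
    have h : (B - C * A) * A⁻¹ = B * A⁻¹ - C := by
      rw [Matrix.sub_mul, mul_nonsing_inv_cancel_right _ _ hdet]
    rw [Matrix.mul_assoc, h, transpose_sub, transpose_mul, hAt]
    simp only [Matrix.sub_mul, Matrix.mul_sub, Matrix.mul_assoc]
    abel
  have hcross : (A * (Cᵀ * K * B * A⁻¹)).trace = (Bᵀ * K * C).trace := by
    rw [trace_mul_comm, nonsing_inv_mul_cancel_right _ _ hdet, ← trace_transpose]
    simp [transpose_mul, hKt, Matrix.mul_assoc]
  rw [hexp, trace_add, trace_sub, trace_sub, hcross, trace_mul_comm A]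
  ring

/-- The matrix fractional function dominates its affine minorants. -/
theorem le_trace_fractional {K : Matrix m m ℝ} (hK : K.PosSemidef)
    (B C : Matrix m k ℝ) {A : Matrix k k ℝ} (hA : A.PosDef) :
    2 * (Bᵀ * K * C).trace - (Cᵀ * K * C * A).trace ≤ (Bᵀ * K * B * A⁻¹).trace := by
  rw [← sub_nonneg, trace_fractional_sub_eq hK B C hA]
  refine trace_mul_nonneg_of_posSemidef ?_ hA.inv.posSemidef
  simpa using hK.conjTranspose_mul_mul_same (B - C * A)

/-- The affine minorant of the matrix fractional function with slope `B * A⁻¹` is attained. -/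
theorem trace_fractional_eq {K : Matrix m m ℝ} (hK : K.PosSemidef)
    (B : Matrix m k ℝ) {A : Matrix k k ℝ} (hA : A.PosDef) :
    (Bᵀ * K * B * A⁻¹).trace =
      2 * (Bᵀ * K * (B * A⁻¹)).trace - ((B * A⁻¹)ᵀ * K * (B * A⁻¹) * A).trace := by
  rw [← sub_eq_zero, trace_fractional_sub_eq hK B _ hA,
    nonsing_inv_mul_cancel_right _ _ hA.det_pos.ne'.isUnit]
  simp

/-- Joint convexity of the matrix fractional function `(B, A) ↦ tr (Bᵀ K B A⁻¹)`. -/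
theorem trace_fractional_convex {K : Matrix m m ℝ} (hK : K.PosSemidef)
    (B₁ B₂ : Matrix m k ℝ) {A₁ A₂ : Matrix k k ℝ} (h1 : A₁.PosDef) (h2 : A₂.PosDef)
    {a b : ℝ} (ha : 0 ≤ a) (hb : 0 ≤ b) (hab : a + b = 1) :
    ((a • B₁ + b • B₂)ᵀ * K * (a • B₁ + b • B₂) * (a • A₁ + b • A₂)⁻¹).trace ≤
      a * (B₁ᵀ * K * B₁ * A₁⁻¹).trace + b * (B₂ᵀ * K * B₂ * A₂⁻¹).trace := by
  rw [trace_fractional_eq hK _ (posDef_convex_comb h1 h2 ha hb hab)]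
  generalize (a • B₁ + b • B₂) * (a • A₁ + b • A₂)⁻¹ = C
  have e1 := mul_le_mul_of_nonneg_left (le_trace_fractional hK B₁ C h1) ha
  have e2 := mul_le_mul_of_nonneg_left (le_trace_fractional hK B₂ C h2) hb
  simp only [transpose_add, transpose_smul, Matrix.add_mul, Matrix.mul_add, Matrix.smul_mul,
    Matrix.mul_smul, trace_add, trace_smul, smul_eq_mul]
  linarith

/-- Convexity of `A ↦ tr A⁻¹` on positive definite matrices. -/
theorem trace_inv_convex {A₁ A₂ : Matrix k k ℝ} (h1 : A₁.PosDef) (h2 : A₂.PosDef)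
    {a b : ℝ} (ha : 0 ≤ a) (hb : 0 ≤ b) (hab : a + b = 1) :
    ((a • A₁ + b • A₂)⁻¹).trace ≤ a * (A₁⁻¹).trace + b * (A₂⁻¹).trace := by
  simpa [← add_smul, hab] using
    trace_fractional_convex PosSemidef.one (1 : Matrix k k ℝ) 1 h1 h2 ha hb hab

end MatrixFractional

/-- Joint convexity of the Sparse Kernel MTL objective (restricted matrix form):
`S(B, A) = ℓ(KB) + λ(tr(BᵀKBA⁻¹) + ε·tr(A⁻¹) + μ·tr(A) + (1−μ)·Σ_{t,s}|A_{ts}|)` is jointly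
convex over `B ∈ ℝ^{n×T}` and symmetric positive definite `A`. -/
theorem stmt_19 (n T : ℕ) (K : Matrix (Fin n) (Fin n) ℝ) (hK : K.PosSemidef)
    (ℓ : Matrix (Fin n) (Fin T) ℝ → ℝ) (hℓ : ConvexOn ℝ Set.univ ℓ)
    (lam ε μ : ℝ) (hlam : 0 ≤ lam) (hε : 0 ≤ ε) (hμ : μ ∈ Set.Icc (0 : ℝ) 1)
    (S : Matrix (Fin n) (Fin T) ℝ → Matrix (Fin T) (Fin T) ℝ → ℝ)
    (hS : ∀ B A, S B A = ℓ (K * B) + lam * ((Bᵀ * K * B * A⁻¹).trace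
      + ε * (A⁻¹).trace + μ * A.trace + (1 - μ) * ∑ t, ∑ s, |A t s|))
    (B₁ B₂ : Matrix (Fin n) (Fin T) ℝ) (A₁ A₂ : Matrix (Fin T) (Fin T) ℝ)
    (h1 : A₁.PosDef) (h2 : A₂.PosDef) (θ : ℝ) (hθ : θ ∈ Set.Icc (0 : ℝ) 1) :
    S (θ • B₁ + (1 - θ) • B₂) (θ • A₁ + (1 - θ) • A₂)
      ≤ θ * S B₁ A₁ + (1 - θ) * S B₂ A₂ := by
  obtain ⟨ha, hθ1⟩ := hθ
  have hb : 0 ≤ 1 - θ := sub_nonneg.2 hθ1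
  have hab : θ + (1 - θ) = 1 := by ring
  have hloss : ℓ (K * (θ • B₁ + (1 - θ) • B₂)) ≤ θ * ℓ (K * B₁) + (1 - θ) * ℓ (K * B₂) := by
    simpa [Matrix.mul_add] using
      hℓ.2 (Set.mem_univ (K * B₁)) (Set.mem_univ (K * B₂)) ha hb hab
  have hfrac := trace_fractional_convex hK B₁ B₂ h1 h2 ha hb hab
  have hinv := mul_le_mul_of_nonneg_left (trace_inv_convex h1 h2 ha hb hab) hε
  have habs := mul_le_mul_of_nonneg_left (sum_abs_convex A₁ A₂ ha hb) (sub_nonneg.2 hμ.2)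
  have htr : (θ • A₁ + (1 - θ) • A₂).trace = θ * A₁.trace + (1 - θ) * A₂.trace := by
    simp [trace_add, trace_smul]
  rw [hS, hS, hS, htr]
  have hpen := mul_le_mul_of_nonneg_left (add_le_add (add_le_add hfrac hinv) habs) hlam
  linarith
end
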